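/- Let T be a tower of type (m,n) over a minimal rotation. Then T is conjugate in 𝔾 to a minimal rotation if and only if m and n are relatively prime. -/

import Mathlib

open Set

namespace IETRoots

noncomputable section

/-- The unit interval `[0,1)`, the domain of our interval exchange transformations. -/
def unitI : Set ℝ := Set.Ico 0 1

/-- `T : ℝ → ℝ` is (the extension by the identity of) an interval exchange
transformation: it fixes the complement of `[0,1)`, maps `[0,1)` bijectively onto
itself, and there is a finite partition of `[0,1)` into half-open intervals on each
of which `T` is a translation.  The group `𝔾` of IETs is the set of such maps under
composition. -/
def IsIET (T : ℝ → ℝ) : Prop :=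
  Set.BijOn T unitI unitI ∧ (∀ x, x ∉ unitI → T x = x) ∧
  ∃ (k : ℕ) (β : Fin (k + 1) → ℝ), StrictMono β ∧ β 0 = 0 ∧ β (Fin.last k) = 1 ∧
    ∀ i : Fin k, ∃ c : ℝ, ∀ x ∈ Set.Ico (β i.castSucc) (β i.succ), T x = x + c

/-- The `ℤ`-orbit `{T^n x : n ∈ ℤ}` of `x` under the bijection `T`. -/
def orbitZ (T : ℝ → ℝ) (x : ℝ) : Set ℝ := {y | ∃ n : ℕ, T^[n] x = y ∨ T^[n] y = x}

/-- `T` is minimal: every orbit is dense in `[0,1)`. -/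
def IsMinimal (T : ℝ → ℝ) : Prop := ∀ x ∈ unitI, unitI ⊆ closure (orbitZ T x)

/-- `T` is of rotation type: `T x = x + α (mod 1)` on `[0,1)`. -/
def IsRotationType (T : ℝ → ℝ) : Prop := ∃ α : ℝ, ∀ x ∈ unitI, T x = Int.fract (x + α)

/-- `T` has an `n`-th root in the group `𝔾` of IETs for some `n ≥ 2`. -/
def HasNontrivialRoot (T : ℝ → ℝ) : Prop :=
  ∃ (S : ℝ → ℝ) (n : ℕ), IsIET S ∧ 2 ≤ n ∧ S^[n] = T

/-- The set `D(T)` of points of `[0,1)` at which `T` is discontinuous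
(as a map of `[0,1)`). -/
def DiscSet (T : ℝ → ℝ) : Set ℝ := {x | x ∈ unitI ∧ ¬ ContinuousWithinAt T unitI x}

/-- `β_j = λ_1 + ⋯ + λ_j` (`0`-indexed: the sum of the first `j` lengths). -/
def betaPt {m : ℕ} (lam : Fin m → ℝ) (j : ℕ) : ℝ :=
  ∑ i ∈ Finset.univ.filter (fun i : Fin m => (i : ℕ) < j), lam i

/-- The interval exchange transformation `T_{(π,λ)}` determined by a permutation
`π ∈ S_m` and a length vector `λ`: on `I_j = [β_{j-1}, β_j)` it is given by
`x ↦ x - ∑_{i<j} λ_i + ∑_{π(i)<π(j)} λ_i`; outside `[0,1)` it is the identity. -/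
noncomputable def ietMap {m : ℕ} (π : Equiv.Perm (Fin m)) (lam : Fin m → ℝ) : ℝ → ℝ :=
  fun x =>
    if h : ∃ j : Fin m, x ∈ Set.Ico (betaPt lam (j : ℕ)) (betaPt lam (j : ℕ) + lam j) then
      x - betaPt lam (h.choose : ℕ) +
        ∑ i ∈ Finset.univ.filter (fun i : Fin m => π i < π h.choose), lam i
    else x

/-- A permutation `π ∈ S_m` is separating if `π(i+1) ≠ π(i) + 1` for `1 ≤ i ≤ m-1`. -/
def Separating {m : ℕ} (π : Equiv.Perm (Fin m)) : Prop :=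
  ∀ i j : Fin m, (j : ℕ) = (i : ℕ) + 1 → (π j : ℕ) ≠ (π i : ℕ) + 1

/-- A permutation `π ∈ S_m` is irreducible if `π({1,…,k}) ≠ {1,…,k}` for all `k < m`. -/
def IrreduciblePerm {m : ℕ} (π : Equiv.Perm (Fin m)) : Prop :=
  ∀ k : ℕ, 1 ≤ k → k < m → ∃ i : Fin m, (i : ℕ) < k ∧ k ≤ (π i : ℕ)

/-- The endpoints `0 = γ_0 < γ_1 < ⋯ < γ_{m-1} < γ_m = 1`, namely the discontinuities
of `T` together with `0` and `1`. -/
def endpointsOf (T : ℝ → ℝ) : Set ℝ := insert 0 (insert 1 (DiscSet T))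

/-- The set of lengths `l_j = γ_j - γ_{j-1}` of the intervals of continuity of `T`,
i.e. the gaps between consecutive endpoints. -/
def gapLengths (T : ℝ → ℝ) : Set ℝ :=
  {l | ∃ a ∈ endpointsOf T, ∃ b ∈ endpointsOf T,
        a < b ∧ (∀ c ∈ endpointsOf T, ¬(a < c ∧ c < b)) ∧ l = b - a}

/-- The rank of `T`: the dimension of the `ℚ`-vector space spanned by the lengths
`l_1, …, l_m`. -/
noncomputable def ietRank (T : ℝ → ℝ) : ℕ :=
  Module.finrank ℚ (Submodule.span ℚ (gapLengths T))

/-- Keane's infinite distinct orbit condition for an `m`-IET `T = T_{(π,λ)}`: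
the orbits of `β_1, …, β_{m-1}` are infinite and pairwise disjoint. -/
def SatisfiesIDOC {m : ℕ} (lam : Fin m → ℝ) (T : ℝ → ℝ) : Prop :=
  (∀ j : ℕ, 1 ≤ j → j ≤ m - 1 → (orbitZ T (betaPt lam j)).Infinite) ∧
  ∀ j j' : ℕ, 1 ≤ j → j ≤ m - 1 → 1 ≤ j' → j' ≤ m - 1 → j ≠ j' →
    orbitZ T (betaPt lam j) ∩ orbitZ T (betaPt lam j') = ∅

/-- A rotation: a `2`-IET with permutation `(21)`, i.e. `x ↦ x + α (mod 1)`
with `α ∈ (0,1)`. -/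
def IsRotation (S : ℝ → ℝ) : Prop :=
  (∀ x, x ∉ unitI → S x = x) ∧ ∃ α ∈ Set.Ioo (0 : ℝ) 1, ∀ x ∈ unitI, S x = Int.fract (x + α)

/-- Conjugacy in the group `𝔾` of IETs. -/
def IsConjugate (T T' : ℝ → ℝ) : Prop := ∃ g : ℝ → ℝ, IsIET g ∧ g ∘ T = T' ∘ g

/-- `T` is a tower of type `(n_1, …, n_k)` over the `k`-IET `S`:  there is a partition
`0 = t_0 < t_1 < ⋯ < t_k = 1` into intervals `I_i` on which `S` is a translation, a
scaling factor `c > 0`, and for each `i` a family of `n_i` pairwise disjoint "levels"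
(scaled copies of `I_i`) which together partition `[0,1)`, such that `T` translates each
level of the `i`-th column onto the next one, and maps the top level back to the bottom
levels according to `S` (all after rescaling by `c`). -/
def IsTowerOver {k : ℕ} (T : ℝ → ℝ) (n : Fin k → ℕ) (S : ℝ → ℝ) : Prop :=
  IsIET T ∧ IsIET S ∧ (∀ i, 0 < n i) ∧
  ∃ (t : Fin (k + 1) → ℝ) (c : ℝ) (a : Fin k → ℕ → ℝ),
    StrictMono t ∧ t 0 = 0 ∧ t (Fin.last k) = 1 ∧ 0 < c ∧
    (∀ i : Fin k, ∃ d : ℝ, ∀ x ∈ Set.Ico (t i.castSucc) (t i.succ), S x = x + d) ∧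
    (∀ i : Fin k, ∀ j : ℕ, j < n i →
      Set.Ico (a i j) (a i j + c * (t i.succ - t i.castSucc)) ⊆ unitI) ∧
    (∀ i i' : Fin k, ∀ j j' : ℕ, j < n i → j' < n i' → (i, j) ≠ (i', j') →
      Disjoint (Set.Ico (a i j) (a i j + c * (t i.succ - t i.castSucc)))
        (Set.Ico (a i' j') (a i' j' + c * (t i'.succ - t i'.castSucc)))) ∧
    (∀ y ∈ unitI, ∃ (i : Fin k) (j : ℕ), j < n i ∧
      y ∈ Set.Ico (a i j) (a i j + c * (t i.succ - t i.castSucc))) ∧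
    (∀ i : Fin k, ∀ j : ℕ, j + 1 < n i → ∀ x ∈ Set.Ico (t i.castSucc) (t i.succ),
      T (a i j + c * (x - t i.castSucc)) = a i (j + 1) + c * (x - t i.castSucc)) ∧
    (∀ i : Fin k, ∀ x ∈ Set.Ico (t i.castSucc) (t i.succ), ∀ i' : Fin k,
      S x ∈ Set.Ico (t i'.castSucc) (t i'.succ) →
      T (a i (n i - 1) + c * (x - t i.castSucc)) = a i' 0 + c * (S x - t i'.castSucc))

/-- The data of the first return map of `T` to `J = [a,b)`: a partition
`a = s_0 < s_1 < ⋯ < s_k = b` of `J`, return times `mt_i ≥ 1` and translation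
constants `c_i` such that for `x` in the `i`-th piece the iterates `T^j x`, `0 < j < mt_i`,
avoid `J`, while `T^{mt_i} x = x + c_i ∈ J`.  Thus the first return map `T_J` is the
`k`-IET `x ↦ x + c_i` on the `i`-th piece. -/
def IsFirstReturnSystem (T : ℝ → ℝ) (a b : ℝ) {k : ℕ} (s : Fin (k + 1) → ℝ)
    (mt : Fin k → ℕ) (c : Fin k → ℝ) : Prop :=
  StrictMono s ∧ s 0 = a ∧ s (Fin.last k) = b ∧
  ∀ i : Fin k, 0 < mt i ∧ ∀ x ∈ Set.Ico (s i.castSucc) (s i.succ),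
    (∀ j : ℕ, 0 < j → j < mt i → T^[j] x ∉ Set.Ico a b) ∧
    T^[mt i] x ∈ Set.Ico a b ∧ T^[mt i] x = x + c i

/-- A finite sequence `x_0, …, x_k` is an `S`-chain if `x_0` and `x_k` lie in
`D(S) ∪ {0}` and `S x_i = x_{i+1}`. -/
def IsSChainSeq (S : ℝ → ℝ) {k : ℕ} (x : Fin (k + 1) → ℝ) : Prop :=
  x 0 ∈ insert (0 : ℝ) (DiscSet S) ∧ x (Fin.last k) ∈ insert (0 : ℝ) (DiscSet S) ∧
  ∀ i : Fin k, S (x i.castSucc) = x i.succ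

/-- A set `C ⊆ ℝ` is (the underlying set of) an `S`-chain. -/
def IsSChain (S : ℝ → ℝ) (C : Set ℝ) : Prop :=
  ∃ (k : ℕ) (x : Fin (k + 1) → ℝ), IsSChainSeq S x ∧ C = Set.range x

/-- A maximal `S`-chain: an `S`-chain which is not a proper subset of another `S`-chain. -/
def IsMaximalSChain (S : ℝ → ℝ) (C : Set ℝ) : Prop :=
  IsSChain S C ∧ ∀ C', IsSChain S C' → C ⊆ C' → C = C'

/-- The open simplex `Δ_m ⊆ ℝ^m`. -/
def simplexSet (m : ℕ) : Set (Fin m → ℝ) := {lam | (∀ i, 0 < lam i) ∧ ∑ i, lam i = 1}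

/-- The affine chart identifying (a superset of) `Δ_m` with a subset of `ℝ^{m-1}`:
`λ_i = x_i` for `i < m-1` and `λ_{m-1} = 1 - ∑ x_j`.  Lebesgue measure on `Δ_m`
is the `(m-1)`-dimensional Lebesgue measure carried through this chart. -/
def chartMap (m : ℕ) (x : Fin (m - 1) → ℝ) : Fin m → ℝ := fun i =>
  if h : (i : ℕ) < m - 1 then x ⟨(i : ℕ), h⟩ else 1 - ∑ j, x j

/-- The permutation `(321) ∈ S_3`, sending `1 ↦ 3`, `2 ↦ 2`, `3 ↦ 1`. -/
def perm321 : Equiv.Perm (Fin 3) :=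
  ⟨fun i => i.rev, fun i => i.rev, fun i => Fin.rev_rev i, fun i => Fin.rev_rev i⟩

end


lemma rot_iter {S : ℝ → ℝ} {α : ℝ} (h : ∀ x ∈ unitI, S x = Int.fract (x + α))
    {x : ℝ} (hx : x ∈ unitI) (k : ℕ) : S^[k] x = Int.fract (x + k * α) := by
  induction k with
  | zero =>
    simp only [Function.iterate_zero, id, Nat.cast_zero, zero_mul, add_zero]
    exact (Int.fract_eq_self.2 ⟨hx.1, hx.2⟩).symm
  | succ k ih =>
    rw [Function.iterate_succ_apply', ih, h _ ⟨Int.fract_nonneg _, Int.fract_lt_one _⟩,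
      Int.fract_eq_fract]
    refine ⟨-⌊x + k * α⌋, ?_⟩
    rw [Int.fract]
    push_cast
    ring

lemma forward_dense {θ : ℝ} (hθ : Irrational θ) (z : ℝ) {u v : ℝ} (hu : 0 ≤ u) (huv : u < v)
    (hv : v ≤ 1) : ∃ k : ℕ, u < Int.fract (z + k * θ) ∧ Int.fract (z + k * θ) < v := by
  have h1 : DenseRange (· • (θ : AddCircle (1:ℝ)) : ℤ → AddCircle (1:ℝ)) := by
    rw [AddCircle.denseRange_zsmul_coe_iff]; simpa using hθ
  have : Fact ((0:ℝ) < 1) := ⟨one_pos⟩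
  rw [denseRange_zsmul_iff_nsmul] at h1
  have ho : IsOpen ((fun w : ℝ => (w : AddCircle (1:ℝ))) '' Ioo (u - z) (v - z)) :=
    QuotientAddGroup.isOpenMap_coe _ isOpen_Ioo
  obtain ⟨k, hk⟩ := h1.exists_mem_open ho
    ⟨_, (u + v) / 2 - z, ⟨by linarith, by linarith⟩, rfl⟩
  obtain ⟨w, hw, hwk⟩ := hk
  have h2 : ((w : ℝ) : AddCircle (1:ℝ)) = ((k • θ : ℝ) : AddCircle (1:ℝ)) := by
    simpa using hwk
  have h3 : ((w - k • θ : ℝ) : AddCircle (1:ℝ)) = 0 := by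
    rw [AddCircle.coe_sub, h2, sub_self]
  obtain ⟨s, hs⟩ := (AddCircle.coe_eq_zero_iff (1:ℝ)).1 h3
  simp only [zsmul_eq_mul, mul_one, nsmul_eq_mul] at hs
  have h4 : Int.fract (z + k * θ) = z + w := by
    rw [Int.fract_eq_iff]
    refine ⟨by linarith [hw.1], by linarith [hw.2], -s, ?_⟩
    push_cast; linarith
  exact ⟨k, by rw [h4]; linarith [hw.1], by rw [h4]; linarith [hw.2]⟩

lemma irr_of_min {S : ℝ → ℝ} {α : ℝ} (h0 : ∀ x, x ∉ unitI → S x = x)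
    (h : ∀ x ∈ unitI, S x = Int.fract (x + α)) (hm : IsMinimal S) : Irrational α := by
  rintro ⟨r, rfl⟩
  have hq : (0:ℝ) < r.den := by exact_mod_cast r.den_pos
  have hz : (0:ℝ) ∈ unitI := ⟨le_refl _, one_pos⟩
  have hrq : (r:ℝ) * r.den = r.num := by exact_mod_cast r.mul_den_eq_num
  have hq1 : (1:ℝ) ≤ r.den := by exact_mod_cast r.den_pos
  have key : ∀ y ∈ orbitZ S 0, ∃ s : ℤ, y * r.den = s := by
    rintro y ⟨k, hk | hk⟩
    · rw [rot_iter h hz] at hk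
      obtain ⟨_, _, s, hs⟩ := Int.fract_eq_iff.1 hk
      refine ⟨k * r.num - s * r.den, ?_⟩
      push_cast
      rw [← hrq, ← hs]; ring
    · by_cases hy : y ∈ unitI
      · rw [rot_iter h hy] at hk
        obtain ⟨_, _, s, hs⟩ := Int.fract_eq_iff.1 hk
        refine ⟨s * r.den - k * r.num, ?_⟩
        push_cast
        rw [← hrq, ← hs]; ring
      · rw [Function.iterate_fixed (h0 y hy)] at hk
        exact absurd (hk ▸ hz) hy
  have hmem : (1 / (2 * r.den) : ℝ) ∈ unitI := by
    refine ⟨by positivity, ?_⟩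
    rw [div_lt_one (by positivity)]; linarith
  have hc := hm 0 hz hmem
  rw [Metric.mem_closure_iff] at hc
  obtain ⟨y, hy, hd⟩ := hc (1 / (2 * r.den)) (by positivity)
  obtain ⟨s, hs⟩ := key y hy
  rw [Real.dist_eq, abs_lt] at hd
  have e : (1 / (2 * r.den) : ℝ) * r.den = 1 / 2 := by field_simp
  have h1 : 0 < y * r.den := mul_pos (by linarith [hd.2]) hq
  have h2 : y * r.den < 1 := by nlinarith [hd.1]
  rw [hs] at h1 h2
  have h3 : 0 < s := by exact_mod_cast h1
  have h4 : s < 1 := by exact_mod_cast h2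
  omega

lemma min_of_irr {S : ℝ → ℝ} {α : ℝ}
    (h : ∀ x ∈ unitI, S x = Int.fract (x + α)) (hα : Irrational α) : IsMinimal S := by
  intro x hx y hy
  rw [Metric.mem_closure_iff]
  intro ε hε
  obtain ⟨k, h1, h2⟩ := forward_dense hα x hy.1
    (lt_min hy.2 (show y < y + ε by linarith)) (min_le_left _ _)
  refine ⟨Int.fract (x + k * α), ⟨k, Or.inl (rot_iter h hx k)⟩, ?_⟩
  rw [Real.dist_eq, abs_lt]
  have := lt_of_lt_of_le h2 (min_le_right _ _)
  constructor <;> linarith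

/-- Partition lemma. -/
lemma exists_partition (g : ℝ → ℝ) (F : Set ℝ) (hF : F.Finite)
    (h : ∀ x ∈ unitI, ∀ y ∈ unitI, x < y → (∀ z ∈ F, ¬ (x < z ∧ z ≤ y)) → g y - y = g x - x) :
    ∃ (k : ℕ) (β : Fin (k + 1) → ℝ), StrictMono β ∧ β 0 = 0 ∧ β (Fin.last k) = 1 ∧
    ∀ i : Fin k, ∃ c : ℝ, ∀ x ∈ Set.Ico (β i.castSucc) (β i.succ), g x = x + c := by
  classical
  set E : Finset ℝ := insert 0 (insert 1 (hF.toFinset.filter (fun x => 0 ≤ x ∧ x ≤ 1))) with hE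
  have hE0 : (0:ℝ) ∈ E := by simp [hE]
  have hE1 : (1:ℝ) ∈ E := by simp [hE]
  have hEb : ∀ x ∈ E, 0 ≤ x ∧ x ≤ 1 := by
    intro x hx
    simp only [hE, Finset.mem_insert, Finset.mem_filter] at hx
    rcases hx with rfl | rfl | hx
    · simp
    · simp
    · exact hx.2
  have hcard : E.card = (E.card - 1) + 1 := by
    have := Finset.card_pos.2 ⟨_, hE0⟩; omega
  set β := E.orderEmbOfFin hcard with hβ
  have hmem : ∀ i, β i ∈ E := fun i => Finset.orderEmbOfFin_mem E hcard i
  have hsurj : ∀ x ∈ E, ∃ i, β i = x := by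
    intro x hx
    have : x ∈ Set.range β := by rw [hβ, Finset.range_orderEmbOfFin]; exact hx
    exact this
  refine ⟨E.card - 1, β, β.strictMono, ?_, ?_, ?_⟩
  · obtain ⟨i, hi⟩ := hsurj 0 hE0
    apply le_antisymm _ (hEb _ (hmem _)).1
    rw [← hi]; exact β.monotone (Fin.zero_le _)
  · obtain ⟨i, hi⟩ := hsurj 1 hE1
    apply le_antisymm (hEb _ (hmem _)).2
    conv_lhs => rw [← hi]
    exact β.monotone (Fin.le_last _)
  · intro i
    refine ⟨g (β i.castSucc) - β i.castSucc, ?_⟩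
    intro x hx
    rcases eq_or_lt_of_le hx.1 with he | hlt
    · rw [← he]; ring
    · have hb := (hEb _ (hmem i.succ)).2
      have hb0 := (hEb _ (hmem i.castSucc)).1
      have := h (β i.castSucc) ⟨hb0, by linarith [hx.2]⟩ x ⟨by linarith, by linarith [hx.2]⟩ hlt ?_
      · linarith
      · rintro z hz ⟨hz1, hz2⟩
        have hzE : z ∈ E := by
          simp only [hE, Finset.mem_insert, Finset.mem_filter, Set.Finite.mem_toFinset]
          exact Or.inr (Or.inr ⟨hz, by linarith, by linarith [hx.2]⟩)
        obtain ⟨j, rfl⟩ := hsurj z hzE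
        have a1 := β.lt_iff_lt.1 hz1
        have a2 := β.lt_iff_lt.1 (lt_of_le_of_lt hz2 hx.2)
        simp only [Fin.lt_def, Fin.val_castSucc, Fin.val_succ] at a1 a2
        omega

/-- Working form of the tower data. -/
structure Tow (T : ℝ → ℝ) (α c : ℝ) (N : Fin 2 → ℕ) (lo hi d : Fin 2 → ℝ)
    (a : Fin 2 → ℕ → ℝ) : Prop where
  cpos : 0 < c
  hc : c * (N 0 * (1 - α) + N 1 * α) = 1
  maps : ∀ y ∈ unitI, T y ∈ unitI
  out : ∀ y, y ∉ unitI → T y = y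
  Npos : ∀ i, 0 < N i
  lohi : ∀ i, lo i < hi i
  mem : ∀ i j x, j < N i → lo i ≤ x → x < hi i → a i j + c * (x - lo i) ∈ unitI
  cover : ∀ y ∈ unitI, ∃ i j x, j < N i ∧ lo i ≤ x ∧ x < hi i ∧ y = a i j + c * (x - lo i)
  uniq : ∀ i j x i' j' x', j < N i → lo i ≤ x → x < hi i → j' < N i' → lo i' ≤ x' → x' < hi i' →
    a i j + c * (x - lo i) = a i' j' + c * (x' - lo i') → i = i' ∧ j = j' ∧ x = x'
  bcover : ∀ x ∈ unitI, ∃ i, lo i ≤ x ∧ x < hi i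
  buniq : ∀ i i' x, lo i ≤ x → x < hi i → lo i' ≤ x → x < hi i' → i = i'
  bmem : ∀ i x, lo i ≤ x → x < hi i → x ∈ unitI
  rot : ∀ i x, lo i ≤ x → x < hi i → x + d i ∈ unitI
  step : ∀ i j x, j + 1 < N i → lo i ≤ x → x < hi i →
    T (a i j + c * (x - lo i)) = a i (j + 1) + c * (x - lo i)
  top : ∀ i x i', lo i ≤ x → x < hi i → lo i' ≤ x + d i → x + d i < hi i' →
    T (a i (N i - 1) + c * (x - lo i)) = a i' 0 + c * (x + d i - lo i')
  d0 : d 0 = α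
  d1 : d 1 = α - 1

lemma tow_measure (N : Fin 2 → ℕ) (l : Fin 2 → ℝ) (hl : ∀ i, 0 ≤ l i) (a : Fin 2 → ℕ → ℝ)
    (hsub : ∀ i : Fin 2, ∀ j : ℕ, j < N i → Set.Ico (a i j) (a i j + l i) ⊆ unitI)
    (hdis : ∀ i i' : Fin 2, ∀ j j' : ℕ, j < N i → j' < N i' → (i, j) ≠ (i', j') →
      Disjoint (Set.Ico (a i j) (a i j + l i)) (Set.Ico (a i' j') (a i' j' + l i')))
    (hcov : ∀ y ∈ unitI, ∃ (i : Fin 2) (j : ℕ), j < N i ∧ y ∈ Set.Ico (a i j) (a i j + l i)) :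
    N 0 * l 0 + N 1 * l 1 = 1 := by
  classical
  set s : Finset (Σ _ : Fin 2, ℕ) :=
    (Finset.univ : Finset (Fin 2)).sigma (fun i => Finset.range (N i)) with hs
  have hmem : ∀ p, p ∈ s ↔ p.2 < N p.1 := by
    rintro ⟨i, j⟩
    simp [hs]
  have hU : unitI = ⋃ p ∈ s, Set.Ico (a p.1 p.2) (a p.1 p.2 + l p.1) := by
    ext y
    simp only [mem_iUnion]
    constructor
    · intro hy
      obtain ⟨i, j, hj, h⟩ := hcov y hy
      exact ⟨⟨i, j⟩, (hmem _).2 hj, h⟩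
    · rintro ⟨p, hp, h⟩
      exact hsub _ _ ((hmem _).1 hp) h
  have hvol : MeasureTheory.volume unitI = 1 := by
    simp [unitI]
  rw [hU, MeasureTheory.measure_biUnion_finset] at hvol
  · have h2 : ∑ p ∈ s, ENNReal.ofReal (l p.1) = 1 := by
      rw [← hvol]
      refine Finset.sum_congr rfl fun p _ => ?_
      rw [Real.volume_Ico]; congr 1; ring
    rw [← ENNReal.ofReal_sum_of_nonneg (fun p _ => hl _)] at h2
    have h3 : ∑ p ∈ s, l p.1 = 1 := by
      rwa [ENNReal.ofReal_eq_one] at h2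
    rw [hs, Finset.sum_sigma] at h3
    simpa using h3
  · intro p hp q hq hne
    exact hdis _ _ _ _ ((hmem p).1 hp) ((hmem q).1 hq) (fun h => hne (by
      obtain ⟨h1, h2⟩ := Prod.mk.inj h
      exact Sigma.ext h1 (heq_of_eq h2)))
  · intro p _
    exact measurableSet_Ico

lemma exists_tow {T S : ℝ → ℝ} {m n : ℕ} {α : ℝ} (hα : α ∈ Ioo (0:ℝ) 1)
    (hS : ∀ x ∈ unitI, S x = Int.fract (x + α)) (hT : IsTowerOver T ![m, n] S) :
    ∃ c lo hi d a, Tow T α c ![m, n] lo hi d a := by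
  obtain ⟨hIT, -, hN, t, c, a, ht, ht0, ht2, hc, htr, hsub, hdis, hcov, hstep, htop⟩ := hT
  obtain ⟨hα0, hα1⟩ := hα
  have ht2' : t 2 = 1 := ht2
  have h01 : t 0 < t 1 := ht (by decide)
  have h12 : t 1 < t 2 := ht (by decide)
  have tr0 := htr 0
  have tr1 := htr 1
  simp only [Fin.castSucc_zero, Fin.succ_zero_eq_one, Fin.castSucc_one, Fin.succ_one_eq_two] at tr0 tr1
  obtain ⟨d0, hd0⟩ := tr0
  obtain ⟨d1, hd1⟩ := tr1
  rw [ht0] at h01 hd0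
  rw [ht2'] at h12 hd1
  have e0 : d0 = α := by
    have := hd0 0 ⟨le_refl _, h01⟩
    rw [hS 0 ⟨le_refl _, one_pos⟩, zero_add, zero_add, Int.fract_eq_self.2 ⟨hα0.le, hα1⟩] at this
    exact this.symm
  subst e0
  have hS1 : S (1 - d0) = 0 := by
    rw [hS _ ⟨by linarith, by linarith⟩]; simp
  have hle : t 1 ≤ 1 - d0 := by
    by_contra! hlt
    have := hd0 (1 - d0) ⟨by linarith, hlt⟩
    rw [hS1] at this; linarith
  have e1 : d1 = d0 - 1 := by
    have := hd1 (1 - d0) ⟨hle, by linarith⟩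
    rw [hS1] at this; linarith
  have ht1 : t 1 = 1 - d0 := by
    rcases eq_or_lt_of_le hle with h | h
    · exact h
    · exfalso
      have h3 := hd1 (t 1) ⟨le_refl _, h12⟩
      have h4 : S (t 1) = t 1 + d0 := by
        rw [hS _ ⟨h01.le, h12⟩, Int.fract_eq_self]
        constructor <;> linarith
      linarith
  have hSd : ∀ i : Fin 2, ∀ x, t i.castSucc ≤ x → x < t i.succ →
      S x = x + (![d0, d0 - 1] : Fin 2 → ℝ) i := by
    intro i x h1 h2
    fin_cases i
    · exact hd0 x ⟨by simpa [ht0] using h1, h2⟩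
    · rw [e1] at hd1
      exact hd1 x ⟨h1, by simpa [ht2'] using h2⟩
  have hbm : ∀ i : Fin 2, ∀ x, t i.castSucc ≤ x → x < t i.succ → x ∈ unitI := by
    intro i x h1 h2
    constructor
    · rw [← ht0]; exact le_trans (ht.monotone (Fin.zero_le _)) h1
    · rw [← ht2]; exact lt_of_lt_of_le h2 (ht.monotone (Fin.le_last _))
  have hlohi : ∀ i : Fin 2, t i.castSucc < t i.succ := fun i => ht (Fin.castSucc_lt_succ)
  have hin : ∀ (i : Fin 2) j x, t i.castSucc ≤ x → x < t i.succ →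
      a i j + c * (x - t i.castSucc) ∈ Ico (a i j) (a i j + c * (t i.succ - t i.castSucc)) := by
    intro i j x h1 h2
    constructor
    · have := mul_nonneg hc.le (sub_nonneg.2 h1); linarith
    · have := mul_lt_mul_of_pos_left (sub_lt_sub_right h2 (t i.castSucc)) hc; linarith
  have hmeas := tow_measure ![m, n] (fun i : Fin 2 => c * (t i.succ - t i.castSucc))
    (fun i => (mul_pos hc (sub_pos.2 (hlohi i))).le) a hsub hdis hcov
  refine ⟨c, fun i => t i.castSucc, fun i => t i.succ, ![d0, d0 - 1], a, hc, ?_, fun y hy => hIT.1.mapsTo hy,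
    hIT.2.1, hN, hlohi, ?_, ?_, ?_, ?_, ?_, hbm, ?_, ?_, ?_, rfl, rfl⟩
  · simp only [Fin.castSucc_zero, Fin.succ_zero_eq_one, Fin.castSucc_one, Fin.succ_one_eq_two, ht0, ht1, ht2'] at hmeas
    linarith
  · intro i j x hj h1 h2
    exact hsub i j hj (hin i j x h1 h2)
  · intro y hy
    obtain ⟨i, j, hj, h1, h2⟩ := hcov y hy
    refine ⟨i, j, t i.castSucc + (y - a i j) / c, hj, ?_, ?_, ?_⟩
    · have := div_nonneg (sub_nonneg.2 h1) hc.le; linarith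
    · have : (y - a i j) / c < t i.succ - t i.castSucc := by
        rw [div_lt_iff₀ hc]; linarith
      linarith
    · field_simp; ring
  · intro i j x i' j' x' hj h1 h2 hj' h1' h2' he
    by_cases hij : (i, j) = (i', j')
    · obtain ⟨rfl, rfl⟩ := Prod.mk.inj hij
      refine ⟨rfl, rfl, ?_⟩
      have : c * (x - t i.castSucc) = c * (x' - t i.castSucc) := by linarith
      have := mul_left_cancel₀ hc.ne' this
      linarith
    · exfalso
      have := hdis i i' j j' hj hj' hij
      exact Set.disjoint_left.1 this (hin i j x h1 h2) (he ▸ hin i' j' x' h1' h2')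
  · intro x hx
    by_cases h : x < t 1
    · exact ⟨0, by simpa [ht0] using hx.1, h⟩
    · exact ⟨1, not_lt.1 h, by simpa [ht2'] using hx.2⟩
  · intro i i' x h1 h2 h3 h4
    fin_cases i <;> fin_cases i'
    · rfl
    · exact absurd (lt_of_le_of_lt h3 h2) (lt_irrefl _)
    · exact absurd (lt_of_le_of_lt h1 h4) (lt_irrefl _)
    · rfl
  · intro i x h1 h2
    rw [← hSd i x h1 h2, hS x (hbm i x h1 h2)]
    exact ⟨Int.fract_nonneg _, Int.fract_lt_one _⟩
  · intro i j x hj h1 h2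
    exact hstep i j hj x ⟨h1, h2⟩
  · intro i x i' h1 h2 h3 h4
    rw [← hSd i x h1 h2] at h3 h4 ⊢
    exact htop i x ⟨h1, h2⟩ i' ⟨h3, h4⟩

lemma iet_local {g : ℝ → ℝ} (hg : IsIET g) {w : ℝ} (hw : w ∈ unitI) :
    ∃ v e : ℝ, w < v ∧ ∀ x ∈ Ico w v, g x = x + e := by
  obtain ⟨-, -, k, β, -, hβ0, hβ1, hβ⟩ := hg
  have key : ∀ i : Fin (k + 1), w < β i → ∃ j : Fin k, β j.castSucc ≤ w ∧ w < β j.succ := by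
    intro i
    induction i using Fin.induction with
    | zero => intro h; rw [hβ0] at h; exact absurd hw.1 (not_le.2 h)
    | succ i ih =>
      intro h
      by_cases h' : w < β i.castSucc
      · exact ih h'
      · exact ⟨i, not_lt.1 h', h⟩
  obtain ⟨j, h1, h2⟩ := key (Fin.last k) (by rw [hβ1]; exact hw.2)
  obtain ⟨e, he⟩ := hβ j
  exact ⟨_, e, h2, fun x hx => he x ⟨h1.trans hx.1, hx.2⟩⟩

lemma conj_coprime {T R g : ℝ → ℝ} {α c θ : ℝ} {N : Fin 2 → ℕ} {lo hi d : Fin 2 → ℝ}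
    {a : Fin 2 → ℕ → ℝ} (tw : Tow T α c N lo hi d a) (hθ : Irrational θ)
    (hR : ∀ x ∈ unitI, R x = Int.fract (x + θ)) (hg : IsIET g) (hgT : g ∘ T = R ∘ g)
    (q : ℕ) (hq0 : 0 < q) (hq : ∀ i, q ∣ N i) : q = 1 := by
  have hlev : ∀ y (r : ZMod q), (∃ i j x, j < N i ∧ lo i ≤ x ∧ x < hi i ∧
      y = a i j + c * (x - lo i) ∧ (j : ZMod q) = r) → (∃ i j x, j < N i ∧ lo i ≤ x ∧ x < hi i ∧
      T y = a i j + c * (x - lo i) ∧ (j : ZMod q) = r + 1) := by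
    rintro y r ⟨i, j, x, hj, h1, h2, rfl, rfl⟩
    by_cases hj' : j + 1 < N i
    · exact ⟨i, j + 1, x, hj', h1, h2, tw.step i j x hj' h1 h2, by push_cast; ring⟩
    · have e : j = N i - 1 := by omega
      obtain ⟨i', h3, h4⟩ := tw.bcover _ (tw.rot i x h1 h2)
      refine ⟨i', 0, x + d i, tw.Npos i', h3, h4, ?_, ?_⟩
      · rw [e]; exact tw.top i x i' h1 h2 h3 h4
      · have : ((j + 1 : ℕ) : ZMod q) = 0 := by
          rw [show j + 1 = N i by omega]; exact (ZMod.natCast_eq_zero_iff _ _).2 (hq i)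
        push_cast at this ⊢
        exact this.symm
  have hlevk : ∀ (k : ℕ) y (r : ZMod q), (∃ i j x, j < N i ∧ lo i ≤ x ∧ x < hi i ∧
      y = a i j + c * (x - lo i) ∧ (j : ZMod q) = r) → (∃ i j x, j < N i ∧ lo i ≤ x ∧ x < hi i ∧
      T^[k] y = a i j + c * (x - lo i) ∧ (j : ZMod q) = r + k) := by
    intro k y r h
    induction k with
    | zero => simpa using h
    | succ k ih =>
      rw [Function.iterate_succ_apply']
      have := hlev _ _ ih
      rw [add_assoc] at this
      push_cast
      exact this
  have hTk : ∀ k y, y ∈ unitI → T^[k] y ∈ unitI := by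
    intro k y hy
    induction k with
    | zero => exact hy
    | succ k ih => rw [Function.iterate_succ_apply']; exact tw.maps _ ih
  have hgk : ∀ k y, g (T^[k] y) = R^[k] (g y) := by
    intro k y
    induction k with
    | zero => rfl
    | succ k ih =>
      rw [Function.iterate_succ_apply', Function.iterate_succ_apply', ← ih]
      exact congrFun hgT _
  set w := a 0 0 + c * (lo 0 - lo 0) with hwdef
  have hw : w ∈ unitI := tw.mem 0 0 (lo 0) (tw.Npos 0) le_rfl (tw.lohi 0)
  obtain ⟨v, e, hv, he⟩ := iet_local hg hw
  have hw0 : w = a 0 0 := by rw [hwdef]; ring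
  set v' := min v (w + c * (hi 0 - lo 0)) with hv'
  have hwv' : w < v' := lt_min hv (by
    have := mul_pos tw.cpos (sub_pos.2 (tw.lohi 0)); linarith)
  have hin : ∀ y ∈ Ico w v', ∃ x, lo 0 ≤ x ∧ x < hi 0 ∧ y = a 0 0 + c * (x - lo 0) := by
    intro y hy
    have hc := tw.cpos
    have h2 := lt_of_lt_of_le hy.2 (min_le_right _ _)
    have h1 := hy.1
    rw [hw0] at h1 h2
    refine ⟨lo 0 + (y - a 0 0) / c, ?_, ?_, ?_⟩
    · have := div_nonneg (sub_nonneg.2 h1) hc.le; linarith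
    · have : (y - a 0 0) / c < hi 0 - lo 0 := by
        rw [div_lt_iff₀ hc]; linarith
      linarith
    · field_simp; ring
  have hinU : ∀ y ∈ Ico w v', y ∈ unitI := by
    intro y hy
    obtain ⟨x, h1, h2, rfl⟩ := hin y hy
    exact tw.mem _ _ _ (tw.Npos 0) h1 h2
  have hge : ∀ y ∈ Ico w v', g y = y + e := fun y hy =>
    he y ⟨hy.1, lt_of_lt_of_le hy.2 (min_le_left _ _)⟩
  have hgU : ∀ y ∈ unitI, g y ∈ unitI := fun y hy => hg.1.mapsTo hy
  have hu0 : 0 ≤ w + e := by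
    rw [← hge w ⟨le_rfl, hwv'⟩]; exact (hgU w hw).1
  have hv1 : v' + e ≤ 1 := by
    by_contra! hlt
    have hy : max w (1 - e) ∈ Ico w v' := ⟨le_max_left _ _, max_lt hwv' (by linarith)⟩
    have h1 := (hgU _ (hinU _ hy)).2
    rw [hge _ hy] at h1
    linarith [le_max_right w (1 - e)]
  have hqθ : Irrational (q * θ) := by
    exact_mod_cast hθ.natCast_mul hq0.ne'
  obtain ⟨k, hk1, hk2⟩ := forward_dense hqθ (g (T w)) hu0 (by linarith : w + e < v' + e) hv1
  have hTw := tw.maps w hw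
  have h5 : g (T^[k * q] (T w)) = Int.fract (g (T w) + k * (q * θ)) := by
    rw [hgk, rot_iter hR (hgU _ hTw)]; push_cast; ring_nf
  rw [← h5] at hk1 hk2
  set y := T^[k * q] (T w) with hy
  have hyU : y ∈ unitI := hTk _ _ hTw
  have hmem : g y - e ∈ Ico w v' := ⟨by linarith, by linarith⟩
  have h6 : g (g y - e) = g y := by rw [hge _ hmem]; ring
  have h7 := hg.1.injOn (hinU _ hmem) hyU h6
  rw [h7] at hmem
  obtain ⟨x, h1, h2, h3⟩ := hin y hmem
  have h8 := hlevk (k * q) _ _ (hlev w 0 ⟨0, 0, lo 0, tw.Npos 0, le_rfl, tw.lohi 0, hwdef, by simp⟩)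
  obtain ⟨i, j, x', hj, h1', h2', h3', hr⟩ := h8
  rw [← hy, h3] at h3'
  obtain ⟨-, h9, -⟩ := tw.uniq _ _ _ _ _ _ (tw.Npos 0) h1 h2 hj h1' h2' h3'
  rw [← h9] at hr
  have h10 : ((1 : ℕ) : ZMod q) = 0 := by
    push_cast at hr ⊢
    simpa using hr.symm
  exact Nat.dvd_one.1 ((ZMod.natCast_eq_zero_iff _ _).1 h10)

lemma fract_congr {x y : ℝ} (s : ℤ) (h : x - y = s) : Int.fract x = Int.fract y :=
  Int.fract_eq_fract.2 ⟨s, h⟩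

lemma coprime_conj {T : ℝ → ℝ} {α c : ℝ} {N : Fin 2 → ℕ} {lo hi d : Fin 2 → ℝ}
    {a : Fin 2 → ℕ → ℝ} (tw : Tow T α c N lo hi d a) (hα : Irrational α) (hα0 : 0 < α)
    (hα1 : α < 1) (p q : ℤ) (hpq : (N 0 : ℤ) * q - N 1 * p = 1) :
    ∃ R : ℝ → ℝ, IsRotation R ∧ IsMinimal R ∧ IsConjugate T R := by
  classical
  have hc := tw.cpos
  have hcL := tw.hc
  have hpq' : (N 0 : ℝ) * q - N 1 * p = 1 := by exact_mod_cast hpq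
  obtain ⟨φ, hφ⟩ : ∃ φ : ℝ, φ = c * ((q - p) * α + p) := ⟨_, rfl⟩
  have hN0 : N 0 * φ = c * α + p := by
    rw [hφ]
    linear_combination c * α * hpq' + p * hcL
  have hN1 : N 1 * φ = c * (α - 1) + q := by
    rw [hφ]
    linear_combination c * (α - 1) * hpq' + q * hcL
  have hNi : ∀ i, ∃ s : ℤ, N i * φ = c * d i + s := by
    intro i
    fin_cases i
    · exact ⟨p, by simp only [Fin.zero_eta, tw.d0]; exact hN0⟩
    · exact ⟨q, by simp only [Fin.mk_one, tw.d1]; exact hN1⟩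
  have hdi : ∀ i, ∃ s : ℤ, α - d i = s := by
    intro i
    fin_cases i
    · exact ⟨0, by simp [tw.d0]⟩
    · exact ⟨1, by simp [tw.d1]⟩
  have hφirr : Irrational φ := by
    rintro ⟨r, hr⟩
    apply hα
    refine ⟨(N 0 * r - p) / ((N 0 - N 1) * r - p + q), ?_⟩
    have h1 : c = (N 0 - N 1) * φ - p + q := by linear_combination hN1 - hN0
    push_cast
    rw [hr, ← h1, div_eq_iff hc.ne']
    linarith
  -- the conjugating map
  choose! I J X hJ hX1 hX2 hy using tw.cover
  set g : ℝ → ℝ := fun y => if y ∈ unitI then Int.fract (c * X y + J y * φ) else y with hg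
  have gout : ∀ y, y ∉ unitI → g y = y := fun y hy => by simp [hg, hy]
  have gpt : ∀ i j x, j < N i → lo i ≤ x → x < hi i →
      g (a i j + c * (x - lo i)) = Int.fract (c * x + j * φ) := by
    intro i j x hj h1 h2
    have hm := tw.mem i j x hj h1 h2
    obtain ⟨-, e2, e3⟩ := tw.uniq _ _ _ _ _ _ hj h1 h2 (hJ _ hm) (hX1 _ hm) (hX2 _ hm) (hy _ hm)
    simp only [hg, hm, if_true]
    rw [← e2, ← e3]
  have gU : ∀ y ∈ unitI, g y ∈ unitI := by
    intro y h
    simp only [hg, h, if_true]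
    exact ⟨Int.fract_nonneg _, Int.fract_lt_one _⟩
  have gT : ∀ y ∈ unitI, g (T y) = Int.fract (g y + φ) := by
    intro y hyU
    obtain ⟨i, j, x, hj, h1, h2, rfl⟩ := tw.cover y hyU
    have hfl : Int.fract (Int.fract (c * x + j * φ) + φ) = Int.fract (c * x + j * φ + φ) :=
      fract_congr (-⌊c * x + j * φ⌋) (by rw [Int.fract]; push_cast; ring)
    rw [gpt i j x hj h1 h2, hfl]
    by_cases hj' : j + 1 < N i
    · rw [tw.step i j x hj' h1 h2, gpt _ _ _ hj' h1 h2]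
      push_cast; ring_nf
    · have e : j = N i - 1 := by omega
      have e' : (j : ℝ) + 1 = N i := by exact_mod_cast (show j + 1 = N i by omega)
      obtain ⟨i', h3, h4⟩ := tw.bcover _ (tw.rot i x h1 h2)
      have := tw.top i x i' h1 h2 h3 h4
      rw [← e] at this
      rw [this, gpt _ _ _ (tw.Npos i') h3 h4]
      obtain ⟨s, hs⟩ := hNi i
      refine fract_congr (-s) ?_
      push_cast
      rw [← e'] at hs
      linear_combination -hs
  have hTk : ∀ k y, y ∈ unitI → T^[k] y ∈ unitI := by
    intro k y hy
    induction k with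
    | zero => exact hy
    | succ k ih => rw [Function.iterate_succ_apply']; exact tw.maps _ ih
  have gTk : ∀ k y, y ∈ unitI → g (T^[k] y) = Int.fract (g y + k * φ) := by
    intro k y hy
    induction k with
    | zero =>
      simp only [Function.iterate_zero, id, Nat.cast_zero, zero_mul, add_zero]
      exact (Int.fract_eq_self.2 ⟨(gU y hy).1, (gU y hy).2⟩).symm
    | succ k ih =>
      rw [Function.iterate_succ_apply', gT _ (hTk _ _ hy), ih]
      refine fract_congr (-⌊g y + k * φ⌋) ?_
      rw [Int.fract]; push_cast; ring
  have up : ∀ i x, lo i ≤ x → x < hi i → ∀ j, j < N i →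
      T^[j] (a i 0 + c * (x - lo i)) = a i j + c * (x - lo i) := by
    intro i x h1 h2 j
    induction j with
    | zero => intro _; rfl
    | succ j ih =>
      intro hj
      rw [Function.iterate_succ_apply', ih (by omega)]
      exact tw.step i j x hj h1 h2
  have base : ∀ (A : ℕ) i x, lo i ≤ x → x < hi i → ∃ K i' x', lo i' ≤ x' ∧ x' < hi i' ∧
      x' = Int.fract (x + A * α) ∧
      T^[K] (a i 0 + c * (x - lo i)) = a i' 0 + c * (x' - lo i') := by
    intro A i x h1 h2
    induction A with
    | zero =>
      refine ⟨0, i, x, h1, h2, ?_, rfl⟩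
      have := tw.bmem i x h1 h2
      simp only [Nat.cast_zero, zero_mul, add_zero]
      exact (Int.fract_eq_self.2 ⟨this.1, this.2⟩).symm
    | succ A ih =>
      obtain ⟨K, i', x', h1', h2', hx', hK⟩ := ih
      have hr := tw.rot i' x' h1' h2'
      obtain ⟨i2, h3, h4⟩ := tw.bcover _ hr
      refine ⟨N i' + K, i2, x' + d i', h3, h4, ?_, ?_⟩
      · obtain ⟨s, hs⟩ := hdi i'
        symm
        rw [Int.fract_eq_iff]
        refine ⟨hr.1, hr.2, s + ⌊x + A * α⌋, ?_⟩
        rw [Int.fract] at hx'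
        push_cast
        rw [← hs, hx']; ring
      · have hNp := tw.Npos i'
        rw [Function.iterate_add_apply, hK, show N i' = (N i' - 1) + 1 by omega,
          Function.iterate_succ_apply', up i' x' h1' h2' _ (by omega)]
        exact tw.top i' x' i2 h1' h2' h3 h4
  have inj_aux : ∀ i j x i' j' x', j < N i → lo i ≤ x → x < hi i → j' < N i' → lo i' ≤ x' →
      x' < hi i' → ∀ (A : ℕ) (B : ℤ), x = x' + A * α + B →
      g (a i j + c * (x - lo i)) = g (a i' j' + c * (x' - lo i')) →
      a i j + c * (x - lo i) = a i' j' + c * (x' - lo i') := by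
    intro i j x i' j' x' hj h1 h2 hj' h1' h2' A B hx he
    obtain ⟨K, i2, x2, h3, h4, hx2, hK⟩ := base A i' x' h1' h2'
    have hxU := tw.bmem i x h1 h2
    have e : x2 = x := by
      rw [hx2, Int.fract_eq_iff]
      exact ⟨hxU.1, hxU.2, -B, by push_cast; linarith⟩
    subst e
    have hxx : a i2 0 + c * (x2 - lo i2) = a i 0 + c * (x2 - lo i) := by
      have : i2 = i := tw.buniq i2 i x2 h3 h4 h1 h2
      rw [this]
    have hb := tw.mem i' 0 x' (tw.Npos i') h1' h2'
    have hy1 : a i j + c * (x2 - lo i) = T^[j + K] (a i' 0 + c * (x' - lo i')) := by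
      rw [Function.iterate_add_apply, hK, hxx, up i x2 h1 h2 j hj]
    have hy2 := up i' x' h1' h2' j' hj'
    rw [hy1, ← hy2, gTk _ _ hb, gTk _ _ hb] at he
    obtain ⟨s, hs⟩ := Int.fract_eq_fract.1 he
    have hjj : j + K = j' := by
      by_contra hne
      have hne' : ((j + K : ℕ) : ℤ) - (j' : ℤ) ≠ 0 := by
        intro h; apply hne; omega
      have := (hφirr.intCast_mul hne').ne_int s
      apply this
      rw [← hs]; push_cast; ring
    rw [hy1, ← hy2, hjj]
  have ginj : Set.InjOn g unitI := by
    intro y1 hy1 y2 hy2 he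
    obtain ⟨i, j, x, hj, h1, h2, rfl⟩ := tw.cover y1 hy1
    obtain ⟨i', j', x', hj', h1', h2', rfl⟩ := tw.cover y2 hy2
    have he' := he
    rw [gpt _ _ _ hj h1 h2, gpt _ _ _ hj' h1' h2'] at he'
    obtain ⟨s, hs⟩ := Int.fract_eq_fract.1 he'
    obtain ⟨A, hA⟩ : ∃ A : ℤ, A = (j' - j) * (q - p) + s * (N 1 - N 0) := ⟨_, rfl⟩
    obtain ⟨B, hB⟩ : ∃ B : ℤ, B = (j' - j) * p + s * N 0 := ⟨_, rfl⟩
    have hA' : (A : ℝ) = (j' - j) * (q - p) + s * (N 1 - N 0) := by rw [hA]; push_cast; ring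
    have hB' : (B : ℝ) = (j' - j) * p + s * N 0 := by rw [hB]; push_cast; ring
    have hx : x = x' + A * α + B := by
      apply mul_left_cancel₀ hc.ne'
      rw [hA', hB']
      linear_combination hs + (j' - j) * hφ - s * hcL
    rcases le_total 0 A with h | h
    · refine inj_aux _ _ _ _ _ _ hj h1 h2 hj' h1' h2' A.toNat B ?_ he
      have : ((A.toNat : ℤ) : ℝ) = A := by rw [Int.toNat_of_nonneg h]
      rw [Int.cast_natCast] at this
      rw [this]; exact hx
    · refine (inj_aux _ _ _ _ _ _ hj' h1' h2' hj h1 h2 (-A).toNat (-B) ?_ he.symm).symm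
      have : (((-A).toNat : ℤ) : ℝ) = (-A : ℤ) := by rw [Int.toNat_of_nonneg (by omega)]
      rw [Int.cast_natCast] at this
      rw [this]; push_cast; linarith
  have gsurj : Set.SurjOn g unitI unitI := by
    intro z hz
    have hlo := tw.bmem 0 (lo 0) le_rfl (tw.lohi 0)
    have hc1 : c ≤ 1 := by
      have a0 : (1:ℝ) ≤ N 0 := by exact_mod_cast tw.Npos 0
      have a1 : (1:ℝ) ≤ N 1 := by exact_mod_cast tw.Npos 1
      have : 1 ≤ N 0 * (1 - α) + N 1 * α := by nlinarith
      nlinarith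
    have hu : 0 ≤ c * lo 0 := mul_nonneg hc.le hlo.1
    have huv : c * lo 0 < min 1 (c * hi 0) :=
      lt_min (by nlinarith [hlo.1, hlo.2]) (mul_lt_mul_of_pos_left (tw.lohi 0) hc)
    obtain ⟨k, hk1, hk2⟩ := forward_dense hφirr.neg z hu huv (min_le_left _ _)
    have hk3 := lt_of_lt_of_le hk2 (min_le_right _ _)
    obtain ⟨x, hx⟩ : ∃ x, Int.fract (z + k * -φ) = c * x :=
      ⟨Int.fract (z + k * -φ) / c, by field_simp⟩
    rw [hx] at hk1 hk3
    have h1 : lo 0 ≤ x := (lt_of_mul_lt_mul_left hk1 hc.le).le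
    have h2 : x < hi 0 := lt_of_mul_lt_mul_left hk3 hc.le
    have hm := tw.mem 0 0 x (tw.Npos 0) h1 h2
    refine ⟨_, hTk k _ hm, ?_⟩
    rw [gTk _ _ hm, gpt _ _ _ (tw.Npos 0) h1 h2, Nat.cast_zero, zero_mul, add_zero, ← hx,
      Int.fract_fract, Int.fract_eq_iff]
    refine ⟨hz.1, hz.2, -⌊z + k * -φ⌋, ?_⟩
    rw [Int.fract]; push_cast; ring
  have giet : IsIET g := by
    refine ⟨⟨gU, ginj, gsurj⟩, gout, ?_⟩
    refine exists_partition g ((⋃ i, (fun j => a i j) '' {j | j < N i}) ∪ {y | y ∈ unitI ∧ g y = 0})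
      ?_ ?_
    · refine Set.Finite.union (Set.finite_iUnion fun i => (Set.finite_lt_nat _).image _) ?_
      refine Set.Subsingleton.finite ?_
      rintro y ⟨h1, h2⟩ y' ⟨h1', h2'⟩
      exact ginj h1 h1' (h2.trans h2'.symm)
    · intro x hxU y hyU hxy hF
      obtain ⟨i, j, u', hj, h1', h2', rfl⟩ := tw.cover y hyU
      have hax : a i j ≤ x := by
        by_contra! hlt
        refine hF (a i j) (Or.inl (mem_iUnion.2 ⟨i, j, hj, rfl⟩)) ⟨hlt, ?_⟩
        have := mul_nonneg hc.le (sub_nonneg.2 h1'); linarith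
      obtain ⟨u, rfl⟩ : ∃ u, x = a i j + c * (u - lo i) :=
        ⟨lo i + (x - a i j) / c, by field_simp; ring⟩
      have h1 : lo i ≤ u := by
        have : 0 ≤ c * (u - lo i) := by linarith
        linarith [nonneg_of_mul_nonneg_right this hc]
      have huu : u < u' := by
        have : c * u < c * u' := by linarith
        exact lt_of_mul_lt_mul_left this hc.le
      have h2 : u < hi i := huu.trans h2'
      rw [gpt _ _ _ hj h1 h2, gpt _ _ _ hj h1' h2']
      have hfl : ⌊c * u' + j * φ⌋ = ⌊c * u + j * φ⌋ := by
        apply le_antisymm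
        · by_contra! hlt
          have b1 := Int.floor_lt.1 hlt
          have b2 := Int.floor_le (c * u' + j * φ)
          obtain ⟨s, hs⟩ : ∃ s, s = ⌊c * u' + j * φ⌋ := ⟨_, rfl⟩
          rw [← hs] at b1 b2
          obtain ⟨w, hw⟩ : ∃ w, c * w = s - j * φ := ⟨(s - j * φ) / c, by field_simp⟩
          have b3 : u < w := lt_of_mul_lt_mul_left (by linarith : c * u < c * w) hc.le
          have b4 : w ≤ u' := le_of_mul_le_mul_left (by linarith : c * w ≤ c * u') hc
          have hm := tw.mem i j w hj (by linarith) (by linarith)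
          refine hF _ (Or.inr ⟨hm, ?_⟩) ⟨?_, ?_⟩
          · rw [gpt _ _ _ hj (by linarith) (by linarith), hw]
            simp
          · linarith
          · linarith
        · apply Int.floor_le_floor
          have := mul_lt_mul_of_pos_left huu hc
          linarith
      rw [Int.fract, Int.fract, hfl]
      ring
  have hfirr : Irrational (Int.fract φ) := by
    rw [Int.fract]; exact hφirr.sub_intCast _
  refine ⟨fun x => if x ∈ unitI then Int.fract (x + Int.fract φ) else x, ⟨?_, Int.fract φ,
    ⟨?_, Int.fract_lt_one _⟩, ?_⟩, ?_, g, giet, ?_⟩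
  · intro x hx; simp [hx]
  · exact lt_of_le_of_ne (Int.fract_nonneg _) hfirr.ne_zero.symm
  · intro x hx; simp [hx]
  · exact min_of_irr (α := Int.fract φ) (fun x hx => by simp [hx]) hfirr
  · funext y
    simp only [Function.comp]
    by_cases hyU : y ∈ unitI
    · rw [if_pos (gU y hyU), gT y hyU]
      exact fract_congr ⌊φ⌋ (by rw [Int.fract]; ring)
    · rw [tw.out y hyU, gout y hyU, if_neg hyU]

theorem stmt4 (T S : ℝ → ℝ) (m n : ℕ)
    (hS : IsRotation S) (hSmin : IsMinimal S)
    (hT : IsTowerOver T ![m, n] S) :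
    (∃ R : ℝ → ℝ, IsRotation R ∧ IsMinimal R ∧ IsConjugate T R) ↔ Nat.Coprime m n := by
  obtain ⟨hS0, α, hα, hSα⟩ := hS
  have hirr := irr_of_min hS0 hSα hSmin
  obtain ⟨c, lo, hi, d, a, tw⟩ := exists_tow hα hSα hT
  constructor
  · rintro ⟨R, ⟨hR0, θ, -, hRθ⟩, hRmin, g, hg, hgT⟩
    refine conj_coprime tw (irr_of_min hR0 hRθ hRmin) hRθ hg hgT (Nat.gcd m n)
      (Nat.gcd_pos_of_pos_left _ (tw.Npos 0)) ?_
    intro i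
    fin_cases i
    · exact Nat.gcd_dvd_left m n
    · exact Nat.gcd_dvd_right m n
  · intro h
    have hb := Nat.gcd_eq_gcd_ab m n
    rw [Nat.Coprime.gcd_eq_one h] at hb
    refine coprime_conj tw hirr hα.1 hα.2 (-Nat.gcdB m n) (Nat.gcdA m n) ?_
    simp only [Matrix.cons_val_zero, Matrix.cons_val_one]
    push_cast at hb
    linarith

end IETRoots
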